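/- Let F be a finite field of characteristic ℓ, W(F) its Witt ring, and B ∈ GL_n(W(F)) a minimal lift of its reduction B̄. Then for every complete noetherian local W(F)-algebra R with residue field F, the centralizer K'(R) := {A ∈ M_n(R) : AB = BA} is a free R-submodule and a direct summand of M_n(R), and its rank is independent of R; in particular rank_R K'(R) = dim_F K'(F). -/

import Mathlib

open Matrix

set_option maxSynthPendingDepth 2

/-- A single (regular unipotent) Jordan block of size `m` with eigenvalue `1`. -/
def jordanBlockOne (R : Type*) [CommRing R] (m : ℕ) : Matrix (Fin m) (Fin m) R :=
  Matrix.of fun i j => if (i : ℕ) = j ∨ (i : ℕ) + 1 = j then 1 else 0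

/-- `B ∈ M_n(W(F))` is a *minimal lift* of `B̄ ∈ M_n(F)` (see the paper): it reduces to
`B̄` and decomposes, up to conjugation, into Kronecker products of a matrix with
irreducible characteristic polynomial and Teichmüller (finite prime-to-`ℓ` order)
semisimple part with a regular unipotent Jordan block. -/
def IsMinimalLift (ℓ : ℕ) [Fact ℓ.Prime] (F : Type*) [Field F] [CharP F ℓ] (n : ℕ)
    (B : Matrix (Fin n) (Fin n) (WittVector ℓ F))
    (Bbar : Matrix (Fin n) (Fin n) F) : Prop :=
  B.map (WittVector.ghostComponent 0) = Bbar ∧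
  ∃ (k : ℕ) (d e : Fin k → ℕ)
    (C : ∀ i : Fin k, Matrix (Fin (d i)) (Fin (d i)) (WittVector ℓ F))
    (eqv : (Σ i : Fin k, Fin (d i) × Fin (e i)) ≃ Fin n)
    (P : Matrix (Fin n) (Fin n) (WittVector ℓ F)),
      (∀ i, Irreducible (C i).charpoly) ∧
      (∀ i, ∃ N : ℕ, 0 < N ∧ ¬ ℓ ∣ N ∧ (C i) ^ N = 1) ∧
      IsUnit P ∧
      B * P = P * (Matrix.reindex eqv eqv (Matrix.blockDiagonal'
        fun i => Matrix.kroneckerMap (· * ·) (C i) (jordanBlockOne (WittVector ℓ F) (e i))))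

open scoped Kronecker

section CommuteLift

variable {M M' : Type*} [Ring M] [Ring M']

/-- Every element whose image commutes with the image of `b` agrees, up to the kernel of `φ`,
with an element commuting with `b`. -/
def CommuteLifts (φ : M →+* M') (b : M) : Prop :=
  ∀ x, Commute (φ b) (φ x) → ∃ x', Commute b x' ∧ φ x' = φ x

theorem CommuteLifts.of_mul_eq_mul {φ : M →+* M'} {b d p : M} (hd : CommuteLifts φ d)
    (hp : IsUnit p) (h : b * p = p * d) : CommuteLifts φ b := by
  obtain ⟨p, rfl⟩ := hp
  have hb : b = p * d * ↑p⁻¹ := by rw [← h, mul_assoc, Units.mul_inv, mul_one]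
  have hd' : d = ↑p⁻¹ * b * p := by rw [mul_assoc, h, ← mul_assoc, Units.inv_mul, one_mul]
  intro x hx
  have e1 : φ ↑p * φ ↑p⁻¹ = 1 := by rw [← map_mul, Units.mul_inv, map_one]
  have e2 : φ ↑p⁻¹ * φ ↑p = 1 := by rw [← map_mul, Units.inv_mul, map_one]
  obtain ⟨y, hy, hyx⟩ := hd (↑p⁻¹ * x * p) (by
    have hx' : φ b * φ x = φ x * φ b := hx
    show φ d * φ _ = φ _ * φ d
    rw [hd']
    simp only [map_mul]
    calc φ ↑p⁻¹ * φ b * φ ↑p * (φ ↑p⁻¹ * φ x * φ ↑p)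
        = φ ↑p⁻¹ * φ b * (φ ↑p * φ ↑p⁻¹) * φ x * φ ↑p := by noncomm_ring
      _ = φ ↑p⁻¹ * (φ b * φ x) * φ ↑p := by rw [e1]; noncomm_ring
      _ = φ ↑p⁻¹ * φ x * (φ ↑p * φ ↑p⁻¹) * φ b * φ ↑p := by rw [hx', e1]; noncomm_ring
      _ = _ := by noncomm_ring)
  refine ⟨p * y * ↑p⁻¹, ?_, ?_⟩
  · have hy' : d * y = y * d := hy
    show b * _ = _ * b
    rw [hb]
    calc ↑p * d * ↑p⁻¹ * (↑p * y * ↑p⁻¹) = ↑p * d * (↑p⁻¹ * ↑p) * y * ↑p⁻¹ := by noncomm_ring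
      _ = ↑p * (d * y) * ↑p⁻¹ := by rw [Units.inv_mul]; noncomm_ring
      _ = ↑p * y * (↑p⁻¹ * ↑p) * d * ↑p⁻¹ := by rw [hy', Units.inv_mul]; noncomm_ring
      _ = _ := by noncomm_ring
  · simp only [map_mul] at hyx ⊢
    rw [hyx]
    calc φ ↑p * (φ ↑p⁻¹ * φ x * φ ↑p) * φ ↑p⁻¹
        = (φ ↑p * φ ↑p⁻¹) * φ x * (φ ↑p * φ ↑p⁻¹) := by noncomm_ring
      _ = φ x := by rw [e1, one_mul, mul_one]

/-- Averaging over the powers of an element of finite order. -/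
theorem exists_commute_average (φ : M →+* M') {s c x : M} {N : ℕ} (hs : s ^ N = 1)
    (hc : ∀ y, Commute c y) (hcN : c * N = 1) (hx : Commute (φ s) (φ x)) :
    ∃ x', Commute s x' ∧ (∀ u, Commute u s → Commute u x → Commute u x') ∧ φ x' = φ x := by
  refine ⟨c * ∑ k ∈ Finset.range N, s ^ k * x * s ^ (N - k), ?_, ?_, ?_⟩
  · refine (hc s).symm.mul_right ?_
    have h1 := Finset.sum_range_succ (fun k => s ^ k * x * s ^ (N + 1 - k)) N
    have h2 := Finset.sum_range_succ' (fun k => s ^ k * x * s ^ (N + 1 - k)) N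
    have h3 : s * ∑ k ∈ Finset.range N, s ^ k * x * s ^ (N - k) =
        ∑ k ∈ Finset.range N, s ^ (k + 1) * x * s ^ (N + 1 - (k + 1)) := by
      rw [Finset.mul_sum]
      refine Finset.sum_congr rfl fun k _ => ?_
      rw [pow_succ', Nat.add_sub_add_right]
      noncomm_ring
    have h4 : (∑ k ∈ Finset.range N, s ^ k * x * s ^ (N - k)) * s =
        ∑ k ∈ Finset.range N, s ^ k * x * s ^ (N + 1 - k) := by
      rw [Finset.sum_mul]
      refine Finset.sum_congr rfl fun k hk => ?_
      rw [mul_assoc, ← pow_succ, Nat.sub_add_comm (Finset.mem_range.1 hk).le]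
    show _ * _ = _ * _
    rw [h3, h4]
    rw [h1] at h2
    have h5 : s ^ N * x * s ^ (N + 1 - N) = s ^ 0 * x * s ^ (N + 1 - 0) := by
      simp [hs, pow_succ]
    rw [h5] at h2
    exact (add_right_cancel h2).symm
  · intro u hus hux
    refine (hc u).symm.mul_right (Commute.sum_right _ _ _ fun k _ => ?_)
    exact ((hus.pow_right k).mul_right hux).mul_right (hus.pow_right _)
  · have h : ∀ k ∈ Finset.range N, φ (s ^ k * x * s ^ (N - k)) = φ x := by
      intro k hk
      have hk' : k + (N - k) = N := by have := Finset.mem_range.1 hk; omega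
      rw [map_mul, map_mul, map_pow, (hx.pow_left k).eq, mul_assoc, map_pow, ← pow_add, hk',
        ← map_pow, hs, map_one, mul_one]
    rw [map_mul, map_sum, Finset.sum_congr rfl h, Finset.sum_const, Finset.card_range,
      nsmul_eq_mul, ← mul_assoc, ← map_natCast φ, ← map_mul, hcN, map_one, one_mul]

/-- Lifting for a commuting product of an element `s` of finite order `N` and an element `u` whose
image has order prime to `N`. -/
theorem CommuteLifts.mul {φ : M →+* M'} {s u c : M} {N q : ℕ} (hsu : Commute s u)
    (hs : s ^ N = 1) (hc : ∀ y, Commute c y) (hcN : c * N = 1)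
    (hq : q.Coprime N) (hN : 0 < N) (huq : φ u ^ q = 1) (hu : CommuteLifts φ u) :
    CommuteLifts φ (s * u) := by
  intro x hx
  have hsN : φ s ^ N = 1 := by rw [← map_pow, hs, map_one]
  have hs' : Commute (φ s) (φ x) := by
    obtain ⟨m, hm⟩ := exists_pow_eq_self_of_coprime
      (Nat.Coprime.coprime_dvd_right (orderOf_dvd_of_pow_eq_one hsN) hq)
    have := (hx.pow_left q).pow_left m
    rwa [map_mul, (hsu.map φ).mul_pow, huq, mul_one, hm] at this
  have hu' : Commute (φ u) (φ x) := by
    have : φ u = φ s ^ (N - 1) * φ (s * u) := by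
      rw [map_mul, ← mul_assoc, ← pow_succ, Nat.sub_add_cancel hN, hsN, one_mul]
    rw [this]
    exact (hs'.pow_left _).mul_left hx
  obtain ⟨y, hy, hyx⟩ := hu x hu'
  obtain ⟨z, hz, hz', hzy⟩ := exists_commute_average φ hs hc hcN (x := y) (by rwa [hyx])
  exact ⟨z, hz.mul_left (hz' u hsu.symm hy), hzy.trans hyx⟩

end CommuteLift

section Jordan

variable {A k : Type*} [CommRing A] [CommRing k]

theorem jordanBlockOne_map (π : A →+* k) (m : ℕ) :
    (jordanBlockOne A m).map π = jordanBlockOne k m := by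
  ext i j
  simp [jordanBlockOne, apply_ite π]

theorem jordanBlockOne_mul_apply {m : ℕ} {β : Type*} (X : Matrix (Fin m) β A) (p : Fin m) (q : β) :
    (jordanBlockOne A m * X) p q = X p q + if h : (p : ℕ) + 1 < m then X ⟨p + 1, h⟩ q else 0 := by
  have h1 : ∀ c : Fin m, jordanBlockOne A m p c * X c q =
      (if p = c then X c q else 0) + if (p : ℕ) + 1 = c then X c q else 0 := by
    intro c
    by_cases h1 : p = c
    · subst h1; simp [jordanBlockOne]
    · have : (p : ℕ) ≠ c := fun h => h1 (Fin.ext h)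
      simp [jordanBlockOne, h1, this]
  rw [Matrix.mul_apply, Finset.sum_congr rfl fun c _ => h1 c, Finset.sum_add_distrib,
    Finset.sum_ite_eq, if_pos (Finset.mem_univ _)]
  congr 1
  split_ifs with h
  · rw [Finset.sum_eq_single ⟨(p : ℕ) + 1, h⟩]
    · simp
    · intro b _ hb
      exact if_neg fun hb' => hb (Fin.ext hb'.symm)
    · simp
  · exact Finset.sum_eq_zero fun c _ => if_neg fun hc => h (by omega)

theorem mul_jordanBlockOne_apply {n : ℕ} {β : Type*} (X : Matrix β (Fin n) A) (p : β) (q : Fin n) :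
    (X * jordanBlockOne A n) p q =
      X p q + if h : 0 < (q : ℕ) then X p ⟨q - 1, by omega⟩ else 0 := by
  have h1 : ∀ c : Fin n, X p c * jordanBlockOne A n c q =
      (if q = c then X p c else 0) + if (c : ℕ) + 1 = q then X p c else 0 := by
    intro c
    by_cases h1 : q = c
    · subst h1; simp [jordanBlockOne]
    · have : (c : ℕ) ≠ q := fun h => h1 (Fin.ext h.symm)
      simp [jordanBlockOne, h1, this]
  rw [Matrix.mul_apply, Finset.sum_congr rfl fun c _ => h1 c, Finset.sum_add_distrib,
    Finset.sum_ite_eq, if_pos (Finset.mem_univ _)]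
  congr 1
  split_ifs with h
  · rw [Finset.sum_eq_single ⟨(q : ℕ) - 1, by omega⟩]
    · simp only []
      exact if_pos (by omega)
    · intro b _ hb
      exact if_neg fun hb' => hb (Fin.ext (by simp only []; omega))
    · simp
  · exact Finset.sum_eq_zero fun c _ => if_neg fun hc => h (by omega)

theorem jordanBlockOne_intertwines_iff {m n : ℕ} (X : Matrix (Fin m) (Fin n) A) :
    jordanBlockOne A m * X = X * jordanBlockOne A n ↔ ∀ (p : Fin m) (q : Fin n),
      (if h : (p : ℕ) + 1 < m then X ⟨p + 1, h⟩ q else 0) =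
        if h : 0 < (q : ℕ) then X p ⟨q - 1, by omega⟩ else 0 := by
  rw [← Matrix.ext_iff]
  refine forall_congr' fun p => forall_congr' fun q => ?_
  rw [jordanBlockOne_mul_apply, mul_jordanBlockOne_apply, add_right_inj]

/-- Intertwiners of Jordan blocks are the matrices that are constant along those diagonals which
run from the first row to the last column, and vanish elsewhere. -/
theorem apply_eq_of_jordanBlockOne_intertwines {m n : ℕ} {X : Matrix (Fin m) (Fin n) A}
    (hX : jordanBlockOne A m * X = X * jordanBlockOne A n) (p : Fin m) (q : Fin n) :
    X p q = if (p : ℕ) ≤ q ∧ n ≤ m + (q - p) then X ⟨0, p.pos⟩ ⟨q - p, by omega⟩ else 0 := by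
  rw [jordanBlockOne_intertwines_iff] at hX
  obtain ⟨p, hp⟩ := p
  obtain ⟨q, hq⟩ := q
  have step : ∀ p q (hp : p + 1 < m) (hq : q + 1 < n),
      X ⟨p + 1, hp⟩ ⟨q + 1, hq⟩ = X ⟨p, by omega⟩ ⟨q, by omega⟩ := by
    intro p q hp hq
    have := hX ⟨p, by omega⟩ ⟨q + 1, hq⟩
    simpa [hp] using this
  have bottom : ∀ q (hm : 0 < m) (hq : q + 1 < n), X ⟨m - 1, by omega⟩ ⟨q, by omega⟩ = 0 := by
    intro q hm hq
    have := hX ⟨m - 1, by omega⟩ ⟨q + 1, hq⟩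
    simpa [Nat.sub_add_cancel hm, eq_comm] using this
  have left : ∀ p (hp : p + 1 < m) (hn : 0 < n), X ⟨p + 1, hp⟩ ⟨0, hn⟩ = 0 := by
    intro p hp hn
    have := hX ⟨p, by omega⟩ ⟨0, hn⟩
    simpa [hp] using this
  have along : ∀ t p q (hp : p + t < m) (hq : q + t < n),
      X ⟨p + t, hp⟩ ⟨q + t, hq⟩ = X ⟨p, by omega⟩ ⟨q, by omega⟩ := by
    intro t
    induction t with
    | zero => intros; rfl
    | succ t ih => intro p q hp hq; exact (step (p + t) (q + t) hp hq).trans (ih p q _ _)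
  simp only []
  split_ifs with h
  · have := along p 0 (q - p) (by omega) (by omega)
    simpa [Nat.sub_add_cancel h.1] using this
  · by_cases hpq : p ≤ q
    · have h' : q + (m - 1 - p) + 1 < n := by
        have : ¬ n ≤ m + (q - p) := fun h'' => h ⟨hpq, h''⟩
        omega
      have h1 := along (m - 1 - p) p q (by omega) (by omega)
      have h2 := bottom (q + (m - 1 - p)) (by omega) h'
      rw [← h1, ← h2]
      congr 2
      omega
    · have h1 := along q (p - q - 1 + 1) 0 (by omega) (by omega)
      rw [left (p - q - 1) (by omega) (by omega)] at h1
      rw [← h1]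
      congr 2 <;> omega

theorem exists_jordanBlockOne_intertwiner (π : A →+* k) {m n : ℕ} (X : Matrix (Fin m) (Fin n) A)
    (hX : jordanBlockOne k m * X.map π = X.map π * jordanBlockOne k n) :
    ∃ X' : Matrix (Fin m) (Fin n) A,
      jordanBlockOne A m * X' = X' * jordanBlockOne A n ∧ X'.map π = X.map π := by
  refine ⟨Matrix.of fun p q => if (p : ℕ) ≤ q ∧ n ≤ m + (q - p) then
    X ⟨0, p.pos⟩ ⟨q - p, by omega⟩ else 0, ?_, ?_⟩
  · rw [jordanBlockOne_intertwines_iff]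
    rintro ⟨p, hp⟩ ⟨q, hq⟩
    simp only [Matrix.of_apply]
    split_ifs <;> first | rfl | omega | skip
    congr 2
    omega
  · ext p q
    rw [apply_eq_of_jordanBlockOne_intertwines hX p q]
    simp only [Matrix.map_apply, Matrix.of_apply, apply_ite π, map_zero]

theorem jordanBlockOne_sub_one_pow (m : ℕ) : (jordanBlockOne A m - 1) ^ m = 0 := by
  have h : (jordanBlockOne A m).charpoly = (Polynomial.X - Polynomial.C 1) ^ m := by
    rw [Matrix.charpoly_of_isUpperTriangular]
    · simp [jordanBlockOne]
    · intro i j hij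
      have : (j : ℕ) < i := hij
      simp only [jordanBlockOne, Matrix.of_apply]
      exact if_neg (by omega)
  have := Matrix.aeval_self_charpoly (jordanBlockOne A m)
  rw [h] at this
  simpa using this

theorem jordanBlockOne_pow_eq_one (ℓ : ℕ) [Fact ℓ.Prime] [CharP k ℓ] {m a : ℕ} (h : m ≤ ℓ ^ a) :
    jordanBlockOne k m ^ ℓ ^ a = 1 := by
  rcases Nat.eq_zero_or_pos m with rfl | hm
  · exact Subsingleton.elim _ _
  have : Nonempty (Fin m) := ⟨⟨0, hm⟩⟩
  have h1 := sub_pow_char_pow_of_commute ℓ a (Commute.one_right (jordanBlockOne k m))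
  rw [one_pow, pow_eq_zero_of_le h (jordanBlockOne_sub_one_pow m)] at h1
  exact (sub_eq_zero.1 h1.symm)

variable {κ : Type*} [DecidableEq κ] {d e : κ → ℕ}

theorem map_blockDiagonal'_one_kronecker_jordanBlockOne (π : A →+* k) (d e : κ → ℕ) :
    (blockDiagonal' fun i => (1 : Matrix (Fin (d i)) (Fin (d i)) A) ⊗ₖ jordanBlockOne A (e i)).map π
      = blockDiagonal' fun i =>
        (1 : Matrix (Fin (d i)) (Fin (d i)) k) ⊗ₖ jordanBlockOne k (e i) := by
  rw [blockDiagonal'_map _ _ (map_zero π)]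
  congr 1
  funext i
  rw [← jordanBlockOne_map π]
  ext ⟨x, p⟩ ⟨y, q⟩
  simp [Matrix.one_apply, apply_ite π]

variable [Fintype κ]

theorem blockDiagonal'_one_kronecker_mul_apply
    (J : ∀ i, Matrix (Fin (e i)) (Fin (e i)) A) {β : Type*}
    (X : Matrix (Σ i, Fin (d i) × Fin (e i)) β A) (i : κ) (x : Fin (d i)) (p : Fin (e i)) (b : β) :
    (blockDiagonal' (fun i => (1 : Matrix (Fin (d i)) (Fin (d i)) A) ⊗ₖ J i) * X) ⟨i, x, p⟩ b =
      ∑ r, J i p r * X ⟨i, x, r⟩ b := by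
  rw [Matrix.mul_apply, Fintype.sum_sigma, Finset.sum_eq_single i, Fintype.sum_prod_type,
    Finset.sum_eq_single x]
  · simp [blockDiagonal'_apply]
  · intro y _ hy
    simp [blockDiagonal'_apply, Matrix.one_apply_ne hy.symm]
  · simp
  · intro j _ hj
    simp [blockDiagonal'_apply_ne _ _ _ hj.symm]
  · simp

theorem mul_blockDiagonal'_one_kronecker_apply
    (J : ∀ i, Matrix (Fin (e i)) (Fin (e i)) A) {β : Type*}
    (X : Matrix β (Σ i, Fin (d i) × Fin (e i)) A) (i : κ) (x : Fin (d i)) (p : Fin (e i)) (b : β) :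
    (X * blockDiagonal' (fun i => (1 : Matrix (Fin (d i)) (Fin (d i)) A) ⊗ₖ J i)) b ⟨i, x, p⟩ =
      ∑ r, X b ⟨i, x, r⟩ * J i r p := by
  rw [Matrix.mul_apply, Fintype.sum_sigma, Finset.sum_eq_single i, Fintype.sum_prod_type,
    Finset.sum_eq_single x]
  · simp [blockDiagonal'_apply]
  · intro y _ hy
    simp [blockDiagonal'_apply, Matrix.one_apply_ne hy]
  · simp
  · intro j _ hj
    simp [blockDiagonal'_apply_ne _ _ _ hj]
  · simp

theorem commute_blockDiagonal'_one_kronecker_iff (J : ∀ i, Matrix (Fin (e i)) (Fin (e i)) A)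
    (X : Matrix (Σ i, Fin (d i) × Fin (e i)) (Σ i, Fin (d i) × Fin (e i)) A) :
    Commute (blockDiagonal' fun i => (1 : Matrix (Fin (d i)) (Fin (d i)) A) ⊗ₖ J i) X ↔
      ∀ i x j y, J i * (Matrix.of fun p q => X ⟨i, x, p⟩ ⟨j, y, q⟩) =
        (Matrix.of fun p q => X ⟨i, x, p⟩ ⟨j, y, q⟩) * J j := by
  constructor
  · intro h i x j y
    ext p q
    have := congrFun (congrFun h.eq ⟨i, x, p⟩) ⟨j, y, q⟩
    rw [blockDiagonal'_one_kronecker_mul_apply, mul_blockDiagonal'_one_kronecker_apply] at this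
    simpa [Matrix.mul_apply] using this
  · intro h
    show _ * _ = _ * _
    ext ⟨i, x, p⟩ ⟨j, y, q⟩
    rw [blockDiagonal'_one_kronecker_mul_apply, mul_blockDiagonal'_one_kronecker_apply]
    simpa [Matrix.mul_apply] using congrFun (congrFun (h i x j y) p) q

theorem commuteLifts_blockDiagonal'_one_kronecker_jordanBlockOne (π : A →+* k) (d e : κ → ℕ) :
    CommuteLifts π.mapMatrix (blockDiagonal' fun i =>
      (1 : Matrix (Fin (d i)) (Fin (d i)) A) ⊗ₖ jordanBlockOne A (e i)) := by
  intro X hX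
  rw [RingHom.mapMatrix_apply, RingHom.mapMatrix_apply,
    map_blockDiagonal'_one_kronecker_jordanBlockOne,
    commute_blockDiagonal'_one_kronecker_iff] at hX
  choose Y hY hYX using fun i x j y => exists_jordanBlockOne_intertwiner π
    (Matrix.of fun p q => X ⟨i, x, p⟩ ⟨j, y, q⟩) (hX i x j y)
  refine ⟨Matrix.of fun a b => Y a.1 a.2.1 b.1 b.2.1 a.2.2 b.2.2, ?_, ?_⟩
  · rw [commute_blockDiagonal'_one_kronecker_iff]
    exact hY
  · ext ⟨i, x, p⟩ ⟨j, y, q⟩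
    exact congrFun (congrFun (hYX i x j y) p) q

theorem one_kronecker_pow {m n : Type*} [Fintype m] [DecidableEq m] [Fintype n] [DecidableEq n]
    (X : Matrix n n A) (r : ℕ) : ((1 : Matrix m m A) ⊗ₖ X) ^ r = 1 ⊗ₖ (X ^ r) := by
  induction r with
  | zero => simp
  | succ r ih => rw [pow_succ, ih, ← mul_kronecker_mul, one_mul, pow_succ]

theorem kronecker_one_pow {m n : Type*} [Fintype m] [DecidableEq m] [Fintype n] [DecidableEq n]
    (X : Matrix m m A) (r : ℕ) : (X ⊗ₖ (1 : Matrix n n A)) ^ r = (X ^ r) ⊗ₖ 1 := by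
  induction r with
  | zero => simp
  | succ r ih => rw [pow_succ, ih, ← mul_kronecker_mul, one_mul, pow_succ]

end Jordan

section Splitting

theorem exists_comp_comp_eq_self {A M N : Type*} [CommRing A] [IsDomain A]
    [IsDiscreteValuationRing A] [AddCommGroup M] [Module A M] [AddCommGroup N] [Module A N]
    [Module.Finite A N] [Module.Free A N] {ϖ : A} (hϖ : Irreducible ϖ) (f : M →ₗ[A] N)
    (hf : ∀ x y, f x = ϖ • y → ∃ z, f z = y) : ∃ s : N →ₗ[A] M, f ∘ₗ s ∘ₗ f = f := by
  have hf' : ∀ (n : ℕ) (y : N), ϖ ^ n • y ∈ LinearMap.range f → y ∈ LinearMap.range f := by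
    intro n
    induction n with
    | zero => intro y hy; simpa using hy
    | succ n ih =>
      rintro y ⟨x, hx⟩
      rw [pow_succ', mul_smul] at hx
      exact ih y (hf x _ hx)
  have : Module.IsTorsionFree A (N ⧸ LinearMap.range f) := by
    refine Module.isTorsionFree_iff_smul_eq_zero.2 fun a y hay => ?_
    obtain ⟨y, rfl⟩ := Submodule.Quotient.mk_surjective _ y
    rw [or_iff_not_imp_left]
    intro ha
    obtain ⟨n, u, rfl⟩ := IsDiscreteValuationRing.eq_unit_mul_pow_irreducible ha hϖ
    rw [← Submodule.Quotient.mk_smul, Submodule.Quotient.mk_eq_zero] at hay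
    rw [Submodule.Quotient.mk_eq_zero]
    refine hf' n y ?_
    have := (LinearMap.range f).smul_mem (↑u⁻¹ : A) hay
    rwa [← mul_smul, ← mul_assoc, Units.inv_mul, one_mul] at this
  obtain ⟨t, ht⟩ := Module.projective_lifting_property (LinearMap.range f).mkQ LinearMap.id
    (Submodule.mkQ_surjective _)
  obtain ⟨u, hu⟩ := Module.projective_lifting_property f.rangeRestrict LinearMap.id
    f.surjective_rangeRestrict
  have hr : ∀ y, (LinearMap.id - t ∘ₗ (LinearMap.range f).mkQ : N →ₗ[A] N) y ∈ LinearMap.range f := by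
    intro y
    rw [← Submodule.Quotient.mk_eq_zero, ← Submodule.mkQ_apply, LinearMap.sub_apply, map_sub,
      sub_eq_zero]
    exact (LinearMap.congr_fun ht ((LinearMap.range f).mkQ y)).symm
  refine ⟨u ∘ₗ LinearMap.codRestrict (LinearMap.range f) _ hr, LinearMap.ext fun x => ?_⟩
  have h1 : LinearMap.codRestrict (LinearMap.range f) _ hr (f x) =
      ⟨f x, LinearMap.mem_range_self f x⟩ := by
    ext
    have : (LinearMap.range f).mkQ (f x) = 0 := by simp
    simp only [LinearMap.codRestrict_apply, LinearMap.sub_apply, LinearMap.comp_apply, this]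
    simp
  simp only [LinearMap.comp_apply]
  rw [h1]
  exact congrArg Subtype.val (LinearMap.congr_fun hu ⟨f x, LinearMap.mem_range_self f x⟩)

/-- A matrix with an inner inverse over a principal ideal domain has a kernel which is split by
matrices. -/
theorem exists_split_ker {A ι : Type*} [CommRing A] [IsDomain A] [IsPrincipalIdealRing A]
    [Fintype ι] [DecidableEq ι] (D S : Matrix ι ι A) (h : D * S * D = D) :
    ∃ (r : ℕ) (G : Matrix ι (Fin r) A) (H : Matrix (Fin r) ι A),
      D * G = 0 ∧ H * G = 1 ∧ G * H + S * D = 1 := by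
  let b := Module.finBasis A (LinearMap.ker D.toLin')
  have hE : ∀ x, (1 - S * D).toLin' x ∈ LinearMap.ker D.toLin' := by
    intro x
    rw [LinearMap.mem_ker, ← LinearMap.comp_apply, ← Matrix.toLin'_mul, mul_sub, ← mul_assoc, h]
    simp
  let η := b.equivFun.toLinearMap ∘ₗ LinearMap.codRestrict _ (1 - S * D).toLin' hE
  let γ := (LinearMap.ker D.toLin').subtype ∘ₗ b.equivFun.symm.toLinearMap
  have h1 : D.toLin' ∘ₗ γ = 0 := by
    ext1 v
    exact LinearMap.ext fun x => (b.equivFun.symm _).2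
  have h2 : γ ∘ₗ η = (1 - S * D).toLin' := by
    refine LinearMap.ext fun x => ?_
    simp [γ, η]
  have h3 : η ∘ₗ γ = LinearMap.id := by
    refine LinearMap.ext fun v => ?_
    apply b.equivFun.symm.injective
    apply Subtype.ext
    show (γ ∘ₗ η) (γ v) = γ v
    have h1' : D.toLin' (γ v) = 0 := LinearMap.congr_fun h1 v
    have h4 : (S * D).toLin' (γ v) = 0 := by
      rw [Matrix.toLin'_mul, LinearMap.comp_apply, h1', map_zero]
    rw [h2, map_sub, LinearMap.sub_apply, h4, Matrix.toLin'_one, sub_zero, LinearMap.id_apply]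
  refine ⟨_, LinearMap.toMatrix' γ, LinearMap.toMatrix' η, ?_, ?_, ?_⟩
  · apply Matrix.toLin'.injective
    rw [Matrix.toLin'_mul, Matrix.toLin'_toMatrix', h1, map_zero]
  · rw [← LinearMap.toMatrix'_comp, h3, LinearMap.toMatrix'_id]
  · rw [← LinearMap.toMatrix'_comp, h2, LinearMap.toMatrix'_toLin', sub_add_cancel]

variable {R M N L : Type*} [CommRing R] [AddCommGroup M] [Module R M] [AddCommGroup N] [Module R N]
  [AddCommGroup L] [Module R L]

/-- The kernel of a split linear map. -/
def kerEquivOfSplit (T : M →ₗ[R] N) (g : L →ₗ[R] M) (h : M →ₗ[R] L) (s : N →ₗ[R] M)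
    (hTg : T ∘ₗ g = 0) (hhg : h ∘ₗ g = LinearMap.id) (hgs : g ∘ₗ h + s ∘ₗ T = LinearMap.id) :
    L ≃ₗ[R] LinearMap.ker T :=
  LinearEquiv.ofLinearMap (LinearMap.codRestrict _ g fun x => LinearMap.congr_fun hTg x)
    (h ∘ₗ (LinearMap.ker T).subtype)
    (by
      refine LinearMap.ext fun x => Subtype.ext ?_
      have := LinearMap.congr_fun hgs x
      rw [LinearMap.add_apply, LinearMap.comp_apply s, LinearMap.mem_ker.1 x.2, map_zero,
        add_zero] at this
      exact this)
    (LinearMap.ext fun x => LinearMap.congr_fun hhg x)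

theorem isCompl_ker_of_split (T : M →ₗ[R] N) (g : L →ₗ[R] M) (h : M →ₗ[R] L) (s : N →ₗ[R] M)
    (hTg : T ∘ₗ g = 0) (hhg : h ∘ₗ g = LinearMap.id) (hgs : g ∘ₗ h + s ∘ₗ T = LinearMap.id) :
    IsCompl (LinearMap.ker T) (LinearMap.ker h) := by
  constructor
  · rw [Submodule.disjoint_def]
    intro x hx hx'
    have := LinearMap.congr_fun hgs x
    simpa [LinearMap.mem_ker.1 hx, LinearMap.mem_ker.1 hx'] using this.symm
  · rw [codisjoint_iff, Submodule.eq_top_iff']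
    intro x
    refine Submodule.mem_sup.2 ⟨g (h x), LinearMap.congr_fun hTg _, x - g (h x), ?_,
      add_sub_cancel _ _⟩
    rw [LinearMap.mem_ker, map_sub, sub_eq_zero]
    exact (LinearMap.congr_fun hhg (h x)).symm

end Splitting

section Centralizer

variable {A : Type*} [CommRing A] {n : Type*} [DecidableEq n]

/-- The matrix of `X ↦ B * X - X * B` on vectorized matrices. -/
def adMatrix (B : Matrix n n A) : Matrix (n × n) (n × n) A :=
  1 ⊗ₖ B - Bᵀ ⊗ₖ 1

theorem adMatrix_map {R : Type*} [CommRing R] (φ : A →+* R) (B : Matrix n n A) :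
    adMatrix (B.map φ) = (adMatrix B).map φ := by
  ext ⟨i, j⟩ ⟨i', j'⟩
  simp [adMatrix, Matrix.one_apply, apply_ite φ]

variable [Fintype n]

theorem adMatrix_mulVec_vec (B X : Matrix n n A) :
    adMatrix B *ᵥ vec X = vec (B * X - X * B) := by
  rw [adMatrix, Matrix.sub_mulVec, kronecker_mulVec_vec, kronecker_mulVec_vec]
  simp

/-- Vectorization of square matrices as a linear equivalence. -/
def vecEquiv (R n : Type*) [CommRing R] : Matrix n n R ≃ₗ[R] (n × n → R) where
  toFun := vec
  invFun v := Matrix.of fun i j => v (j, i)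
  map_add' _ _ := rfl
  map_smul' _ _ := rfl
  left_inv _ := rfl
  right_inv _ := rfl

theorem vecEquiv_mulLeft_sub_mulRight (B X : Matrix n n A) :
    vecEquiv A n ((LinearMap.mulLeft A B - LinearMap.mulRight A B) X) =
      adMatrix B *ᵥ vecEquiv A n X :=
  (adMatrix_mulVec_vec B X).symm

/-- If the kernel of the commutator map of `B` is split by matrices, then the centralizer of `B` is
free, a direct summand, and of constant rank after every base change. -/
theorem free_isCompl_finrank_centralizer {B : Matrix n n A} {S : Matrix (n × n) (n × n) A} {r : ℕ}
    {G : Matrix (n × n) (Fin r) A} {H : Matrix (Fin r) (n × n) A} (hDG : adMatrix B * G = 0)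
    (hHG : H * G = 1) (hGH : G * H + S * adMatrix B = 1) {R : Type*} [CommRing R] [Nontrivial R]
    (φ : A →+* R) :
    Module.Free R (LinearMap.ker
      (LinearMap.mulLeft R (B.map φ) - LinearMap.mulRight R (B.map φ))) ∧
    (∃ Wc : Submodule R (Matrix n n R), IsCompl (LinearMap.ker
      (LinearMap.mulLeft R (B.map φ) - LinearMap.mulRight R (B.map φ))) Wc) ∧
    Module.finrank R (LinearMap.ker
      (LinearMap.mulLeft R (B.map φ) - LinearMap.mulRight R (B.map φ))) = r := by
  have hDG' : adMatrix (B.map φ) * G.map φ = 0 := by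
    rw [adMatrix_map, ← Matrix.map_mul, hDG, Matrix.map_zero _ (map_zero φ)]
  have hHG' : H.map φ * G.map φ = 1 := by
    rw [← Matrix.map_mul, hHG, Matrix.map_one _ (map_zero φ) (map_one φ)]
  have hGH' : G.map φ * H.map φ + S.map φ * adMatrix (B.map φ) = 1 := by
    rw [adMatrix_map, ← Matrix.map_mul, ← Matrix.map_mul, ← Matrix.map_add _ (map_add φ), hGH,
      Matrix.map_one _ (map_zero φ) (map_one φ)]
  let v := vecEquiv R n
  have hTg : (LinearMap.mulLeft R (B.map φ) - LinearMap.mulRight R (B.map φ)) ∘ₗ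
      (v.symm.toLinearMap ∘ₗ (G.map φ).mulVecLin) = 0 := by
    refine LinearMap.ext fun x => v.injective ?_
    rw [LinearMap.comp_apply, vecEquiv_mulLeft_sub_mulRight]
    simp [v, hDG']
  have hhg : ((H.map φ).mulVecLin ∘ₗ v.toLinearMap) ∘ₗ
      (v.symm.toLinearMap ∘ₗ (G.map φ).mulVecLin) = LinearMap.id := by
    refine LinearMap.ext fun x => ?_
    simp [hHG']
  have hgs : (v.symm.toLinearMap ∘ₗ (G.map φ).mulVecLin) ∘ₗ
      ((H.map φ).mulVecLin ∘ₗ v.toLinearMap) +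
      (v.symm.toLinearMap ∘ₗ (S.map φ).mulVecLin ∘ₗ v.toLinearMap) ∘ₗ
        (LinearMap.mulLeft R (B.map φ) - LinearMap.mulRight R (B.map φ)) = LinearMap.id := by
    refine LinearMap.ext fun x => v.injective ?_
    simp only [LinearMap.add_apply, LinearMap.comp_apply, LinearEquiv.coe_coe, map_add,
      LinearEquiv.apply_symm_apply, Matrix.mulVecLin_apply, LinearMap.id_apply]
    rw [vecEquiv_mulLeft_sub_mulRight, Matrix.mulVec_mulVec, Matrix.mulVec_mulVec,
      ← Matrix.add_mulVec, hGH', Matrix.one_mulVec]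
  let E := kerEquivOfSplit _ _ _ _ hTg hhg hgs
  refine ⟨Module.Free.of_equiv E, ⟨_, isCompl_ker_of_split _ _ _ _ hTg hhg hgs⟩, ?_⟩
  rw [← E.finrank_eq, Module.finrank_fin_fun]

/-- If commutation with `B` lifts along the reduction modulo a uniformizer, then the commutator
map of `B` has an inner inverse. -/
theorem CommuteLifts.exists_adMatrix_mul_mul {k : Type*} [CommRing k] [IsDomain A]
    [IsDiscreteValuationRing A] {ϖ : A} (hϖ : Irreducible ϖ) {π : A →+* k}
    (hπ : ∀ x, π x = 0 ↔ ϖ ∣ x) {B : Matrix n n A} (hB : CommuteLifts π.mapMatrix B) :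
    ∃ S, adMatrix B * S * adMatrix B = adMatrix B := by
  obtain ⟨s, hs⟩ := exists_comp_comp_eq_self hϖ (adMatrix B).toLin' (by
    intro x y hxy
    obtain ⟨X, rfl⟩ := (vecEquiv A n).surjective x
    obtain ⟨Y, rfl⟩ := (vecEquiv A n).surjective y
    rw [Matrix.toLin'_apply, ← vecEquiv_mulLeft_sub_mulRight, ← map_smul] at hxy
    replace hxy : B * X - X * B = ϖ • Y := (vecEquiv A n).injective hxy
    obtain ⟨X', hX', hXX'⟩ := hB X (by
      show _ * _ = _ * _
      rw [← sub_eq_zero, ← map_mul, ← map_mul, ← map_sub, hxy]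
      ext i j
      simp [(hπ ϖ).2 dvd_rfl])
    have hdvd : ∀ i j, ϖ ∣ X i j - X' i j := fun i j => by
      rw [← hπ, map_sub, sub_eq_zero]
      exact (congrFun (congrFun hXX' i) j).symm
    choose Z hZ using hdvd
    have hZ' : X - X' = ϖ • Matrix.of Z := by
      ext i j
      simp [hZ]
    refine ⟨vecEquiv A n (Matrix.of Z), ?_⟩
    rw [Matrix.toLin'_apply, ← vecEquiv_mulLeft_sub_mulRight]
    congr 1
    apply smul_right_injective _ hϖ.ne_zero
    show ϖ • (B * Matrix.of Z - Matrix.of Z * B) = ϖ • Y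
    rw [← hxy, smul_sub, ← Matrix.mul_smul, ← Matrix.smul_mul, ← hZ', mul_sub, sub_mul, hX'.eq]
    abel)
  refine ⟨LinearMap.toMatrix' s, Matrix.toLin'.injective ?_⟩
  rw [Matrix.toLin'_mul, Matrix.toLin'_mul, Matrix.toLin'_toMatrix', LinearMap.comp_assoc, hs]

end Centralizer

section Witt

theorem WittVector.ghostComponent_zero_apply {p : ℕ} [Fact p.Prime] {k : Type*} [CommRing k]
    (x : WittVector p k) : WittVector.ghostComponent 0 x = x.coeff 0 := by
  rw [WittVector.ghostComponent_apply, wittPolynomial_zero, MvPolynomial.aeval_X]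

theorem CommuteLifts.reindex {A k m n : Type*} [CommRing A] [CommRing k] [Fintype m]
    [DecidableEq m] [Fintype n] [DecidableEq n] {π : A →+* k} (f : m ≃ n) {B : Matrix m m A}
    (hB : CommuteLifts π.mapMatrix B) : CommuteLifts π.mapMatrix (Matrix.reindex f f B) := by
  intro X hX
  obtain ⟨Y, hY, hYX⟩ := hB (Matrix.reindex f.symm f.symm X) (by
    have := hX.map (Matrix.reindexRingEquiv k f.symm)
    convert this using 1 <;> ext i j <;> simp)
  refine ⟨Matrix.reindex f f Y, hY.map (Matrix.reindexRingEquiv A f), ?_⟩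
  ext i j
  simpa using congrFun (congrFun hYX (f.symm i)) (f.symm j)

theorem IsMinimalLift.commuteLifts {ℓ : ℕ} [Fact ℓ.Prime] {F : Type*} [Field F] [Fintype F]
    [CharP F ℓ] {n : ℕ} {B : Matrix (Fin n) (Fin n) (WittVector ℓ F)}
    {Bbar : Matrix (Fin n) (Fin n) F} (h : IsMinimalLift ℓ F n B Bbar) :
    CommuteLifts (WittVector.ghostComponent 0).mapMatrix B := by
  obtain ⟨-, κ, d, e, C, f, P, -, hC, hP, hBP⟩ := h
  choose N hN hℓN hCN using hC
  have hcop : (∏ i, N i).Coprime ℓ := Nat.Coprime.prod_left fun i _ =>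
    (((Fact.out : ℓ.Prime).coprime_iff_not_dvd).2 (hℓN i)).symm
  have hunit : IsUnit ((∏ i, N i : ℕ) : WittVector ℓ F) := by
    apply WittVector.isUnit_of_coeff_zero_ne_zero
    rw [← WittVector.ghostComponent_zero_apply, map_natCast, Ne, CharP.cast_eq_zero_iff F ℓ]
    exact ((Fact.out : ℓ.Prime).coprime_iff_not_dvd).1 hcop.symm
  obtain ⟨c, hc⟩ := hunit.exists_left_inv
  refine CommuteLifts.of_mul_eq_mul ?_ hP hBP
  refine CommuteLifts.reindex f ?_
  have hsplit : (blockDiagonal' fun i =>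
      kroneckerMap (· * ·) (C i) (jordanBlockOne (WittVector ℓ F) (e i))) =
      (blockDiagonal' fun i => C i ⊗ₖ (1 : Matrix (Fin (e i)) (Fin (e i)) (WittVector ℓ F))) *
      blockDiagonal' fun i =>
        (1 : Matrix (Fin (d i)) (Fin (d i)) _) ⊗ₖ jordanBlockOne (WittVector ℓ F) (e i) := by
    rw [← blockDiagonal'_mul]
    congr 1
    funext i
    rw [← mul_kronecker_mul, mul_one, one_mul]
  rw [hsplit]
  refine CommuteLifts.mul (c := algebraMap (WittVector ℓ F) _ c) (N := ∏ i, N i)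
    (q := ℓ ^ ∑ i, e i) ?_ ?_ (fun y => Algebra.commutes c y) ?_ (hcop.symm.pow_left _)
    (Finset.prod_pos fun i _ => hN i) ?_
    (commuteLifts_blockDiagonal'_one_kronecker_jordanBlockOne _ d e)
  · show _ * _ = _ * _
    rw [← blockDiagonal'_mul, ← blockDiagonal'_mul]
    congr 1
    funext i
    rw [← mul_kronecker_mul, ← mul_kronecker_mul, mul_one, one_mul, mul_one, one_mul]
  · rw [← blockDiagonal'_pow, ← blockDiagonal'_one]
    congr 1
    funext i
    rw [Pi.pow_apply, kronecker_one_pow, Pi.one_apply]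
    obtain ⟨t, ht⟩ := Finset.dvd_prod_of_mem N (Finset.mem_univ i)
    rw [ht, pow_mul, hCN, one_pow, one_kronecker_one]
  · rw [← map_natCast (algebraMap (WittVector ℓ F) _), ← map_mul, hc, map_one]
  · rw [RingHom.mapMatrix_apply, map_blockDiagonal'_one_kronecker_jordanBlockOne,
      ← blockDiagonal'_pow, ← blockDiagonal'_one]
    congr 1
    funext i
    rw [Pi.pow_apply, one_kronecker_pow, Pi.one_apply, jordanBlockOne_pow_eq_one ℓ,
      one_kronecker_one]
    exact (Finset.single_le_sum (fun _ _ => Nat.zero_le _) (Finset.mem_univ i)).trans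
      (Nat.lt_pow_self (Fact.out : ℓ.Prime).one_lt).le

end Witt

/-- Let `B ∈ GL_n(W(F))` be a minimal lift of its reduction `B̄`.  For
every complete noetherian local `W(F)`-algebra `R` with residue field `F`, the
centralizer `K'(R) = {A ∈ M_n(R) : AB = BA}` is a free direct summand of `M_n(R)`
whose rank is independent of `R`: it equals `dim_F K'(F)`. -/
theorem minimal_lift_centralizer_free
    (ℓ : ℕ) [Fact ℓ.Prime] (F : Type*) [Field F] [Fintype F] [CharP F ℓ] (n : ℕ)
    (Bbar : Matrix (Fin n) (Fin n) F) (hBbar : IsUnit Bbar)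
    (B : Matrix (Fin n) (Fin n) (WittVector ℓ F)) (hB : IsUnit B)
    (hlift : IsMinimalLift ℓ F n B Bbar)
    (R : Type*) [CommRing R] [Algebra (WittVector ℓ F) R]
    [IsLocalRing R] [IsNoetherianRing R]
    [IsAdicComplete (IsLocalRing.maximalIdeal R) R]
    (res : IsLocalRing.ResidueField R ≃+* F) :
    Module.Free R
      (LinearMap.ker
        (LinearMap.mulLeft R (B.map (algebraMap (WittVector ℓ F) R)) -
         LinearMap.mulRight R (B.map (algebraMap (WittVector ℓ F) R)))) ∧
    (∃ Wc : Submodule R (Matrix (Fin n) (Fin n) R),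
      IsCompl
        (LinearMap.ker
          (LinearMap.mulLeft R (B.map (algebraMap (WittVector ℓ F) R)) -
           LinearMap.mulRight R (B.map (algebraMap (WittVector ℓ F) R)))) Wc) ∧
    Module.finrank R
      (LinearMap.ker
        (LinearMap.mulLeft R (B.map (algebraMap (WittVector ℓ F) R)) -
         LinearMap.mulRight R (B.map (algebraMap (WittVector ℓ F) R))))
      = Module.finrank F
          (LinearMap.ker
            (LinearMap.mulLeft F Bbar - LinearMap.mulRight F Bbar)) := by
  obtain ⟨S, hS⟩ := hlift.commuteLifts.exists_adMatrix_mul_mul (WittVector.irreducible ℓ)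
    fun x => by
      rw [WittVector.ghostComponent_zero_apply, ← WittVector.mem_span_p_iff_coeff_zero_eq_zero,
        Ideal.mem_span_singleton]
  obtain ⟨r, G, H, hDG, hHG, hGH⟩ := exists_split_ker _ S hS
  obtain ⟨h1, h2, h3⟩ :=
    free_isCompl_finrank_centralizer hDG hHG hGH (algebraMap (WittVector ℓ F) R)
  obtain ⟨-, -, h4⟩ :=
    free_isCompl_finrank_centralizer hDG hHG hGH (WittVector.ghostComponent (R := F) 0)
  rw [hlift.1] at h4
  exact ⟨h1, h2, h3.trans h4.symm⟩
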